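/- Let g be a nondegenerate symmetric bilinear form on V with musical isomorphisms g♭ : V → V* and g♯ = (g♭)⁻¹, and let b be an alternating bilinear form on V. Define G_g(X,ξ) = (g♯(ξ), g♭(X)), e^b(X,ξ) = (X, ξ + b♭(X)), and G = e^b ∘ G_g ∘ e^{−b}, so that explicitly G(X,ξ) = (−g♯(b♭(X)) + g♯(ξ), g♭(X) − b♭(g♯(b♭(X))) + b♭(g♯(ξ))). Then: G ∘ G = id_E; ⟨G(u), G(v)⟩ = ⟨u, v⟩ for all u, v ∈ E; the +1-eigenspace of G is exactly the graph {(X, g♭(X) + b♭(X)) : X ∈ V}; and the −1-eigenspace of G is exactly the graph {(X, −g♭(X) + b♭(X)) : X ∈ V}. In particular, for any pseudo-Riemannian g the operator G is a generalized almost product structure whose eigenspaces have equal dimension. (Remark 3.3 on G = e^{−b}G_g e^{b} and its matrix, extended to pseudo-Riemannian metrics as in Remark 6.1.1.) -/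

import Mathlib

/-- The natural pairing on `E = V × V*`: `⟨(X,ξ),(Y,η)⟩ = (1/2)(η(X) + ξ(Y))`. -/
noncomputable def natPair {V : Type*} [AddCommGroup V] [Module ℝ V]
    (u v : V × Module.Dual ℝ V) : ℝ :=
  (v.2 u.1 + u.2 v.1) / 2

/-- The operator `G = e^b ∘ G_g ∘ e^{-b}` on `E = V × V*` determined by a
nondegenerate symmetric bilinear form `g` (with inverse `g♯ = g'`) and a 2-form `b`:
`G(X,ξ) = (−g♯(b♭X) + g♯ξ, g♭X − b♭(g♯(b♭X)) + b♭(g♯ξ))`. -/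
def genMetricOp {V : Type*} [AddCommGroup V] [Module ℝ V]
    (g b : V →ₗ[ℝ] Module.Dual ℝ V) (g' : Module.Dual ℝ V →ₗ[ℝ] V)
    (p : V × Module.Dual ℝ V) : V × Module.Dual ℝ V :=
  (-g' (b p.1) + g' p.2, g p.1 - b (g' (b p.1)) + b (g' p.2))

/-- In the coordinates `(X, g Y + b X)` on `E`, the operator `G` swaps `X` and `Y`. -/
theorem genMetricOp_apply_mk {V : Type*} [AddCommGroup V] [Module ℝ V]
    {g b : V →ₗ[ℝ] Module.Dual ℝ V} {g' : Module.Dual ℝ V →ₗ[ℝ] V}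
    (hg : ∀ X, g' (g X) = X) (X Y : V) :
    genMetricOp g b g' (X, g Y + b X) = (Y, g X + b Y) := by
  simp only [genMetricOp, map_add, hg, Prod.mk.injEq]
  constructor <;> abel

theorem exists_eq_mk_add {V : Type*} [AddCommGroup V] [Module ℝ V]
    {g : V →ₗ[ℝ] Module.Dual ℝ V} (b : V →ₗ[ℝ] Module.Dual ℝ V)
    (hg : Function.Surjective g) (p : V × Module.Dual ℝ V) :
    ∃ X Y : V, p = (X, g Y + b X) := by
  obtain ⟨Y, hY⟩ := hg (p.2 - b p.1)
  exact ⟨p.1, Y, by simp [hY]⟩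

/-- The natural pairing in the coordinates `(X, g Y + b X)` does not depend on `b`. -/
theorem natPair_mk_add {V : Type*} [AddCommGroup V] [Module ℝ V]
    (g : V →ₗ[ℝ] Module.Dual ℝ V) {b : V →ₗ[ℝ] Module.Dual ℝ V}
    (hb : LinearMap.IsAlt b) (X Y X' Y' : V) :
    natPair (X, g Y + b X) (X', g Y' + b X') = (g Y' X + g Y X') / 2 := by
  have h := hb.neg X X'
  simp only [natPair, LinearMap.add_apply]
  linarith

theorem LinearMap.finrank_graph {R M N : Type*} [Ring R] [AddCommGroup M]
    [AddCommGroup N] [Module R M] [Module R N] (f : M →ₗ[R] N) :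
    Module.finrank R f.graph = Module.finrank R M := by
  rw [LinearMap.graph_eq_range_prod]
  exact LinearMap.finrank_range_of_inj fun _ _ h => congrArg Prod.fst h

/-- Remarks 3.3 and 6.1.1: for a nondegenerate symmetric bilinear form `g` (with
musical inverse `g'`) and an alternating form `b`, the operator
`G = e^b ∘ G_g ∘ e^{-b}` squares to the identity, preserves the natural pairing,
its `+1`-eigenspace is exactly the graph of `g+b`, its `−1`-eigenspace is exactly
the graph of `−g+b`, and the two eigenspaces have equal dimension `dim V`; so `G`
is a generalized almost product structure. -/
theorem stmt_14 (V : Type*) [AddCommGroup V] [Module ℝ V] [FiniteDimensional ℝ V]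
    (g b : V →ₗ[ℝ] Module.Dual ℝ V) (g' : Module.Dual ℝ V →ₗ[ℝ] V)
    (hsymm : ∀ X Y : V, g X Y = g Y X)
    (hg1 : g ∘ₗ g' = LinearMap.id) (hg2 : g' ∘ₗ g = LinearMap.id)
    (halt : ∀ X : V, b X X = 0) :
    (∀ p : V × Module.Dual ℝ V, genMetricOp g b g' (genMetricOp g b g' p) = p)
    ∧ (∀ u v : V × Module.Dual ℝ V,
        natPair (genMetricOp g b g' u) (genMetricOp g b g' v) = natPair u v)
    ∧ (∀ p : V × Module.Dual ℝ V,
        genMetricOp g b g' p = p ↔ ∃ X : V, p = (X, g X + b X))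
    ∧ (∀ p : V × Module.Dual ℝ V,
        genMetricOp g b g' p = -p ↔ ∃ X : V, p = (X, -g X + b X))
    ∧ Module.finrank ℝ (LinearMap.graph (g + b)) = Module.finrank ℝ V
    ∧ Module.finrank ℝ (LinearMap.graph (-g + b)) = Module.finrank ℝ V := by
  have hl : ∀ X, g' (g X) = X := LinearMap.congr_fun hg2
  have hs : Function.Surjective g := fun ξ => ⟨g' ξ, LinearMap.congr_fun hg1 ξ⟩
  refine ⟨fun p => ?_, fun u v => ?_, fun p => ?_, fun p => ?_,
    LinearMap.finrank_graph _, LinearMap.finrank_graph _⟩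
  · obtain ⟨X, Y, rfl⟩ := exists_eq_mk_add b hs p
    rw [genMetricOp_apply_mk hl, genMetricOp_apply_mk hl]
  · obtain ⟨X, Y, rfl⟩ := exists_eq_mk_add b hs u
    obtain ⟨X', Y', rfl⟩ := exists_eq_mk_add b hs v
    rw [genMetricOp_apply_mk hl, genMetricOp_apply_mk hl, natPair_mk_add g halt,
      natPair_mk_add g halt, hsymm X' Y, hsymm X Y', add_comm]
  · constructor
    · intro h
      obtain ⟨X, Y, rfl⟩ := exists_eq_mk_add b hs p
      rw [genMetricOp_apply_mk hl] at h
      obtain rfl : Y = X := congrArg Prod.fst h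
      exact ⟨Y, rfl⟩
    · rintro ⟨X, rfl⟩
      exact genMetricOp_apply_mk hl X X
  · constructor
    · intro h
      obtain ⟨X, Y, rfl⟩ := exists_eq_mk_add b hs p
      rw [genMetricOp_apply_mk hl] at h
      obtain rfl : Y = -X := congrArg Prod.fst h
      exact ⟨X, by rw [map_neg]⟩
    · rintro ⟨X, rfl⟩
      rw [← map_neg, genMetricOp_apply_mk hl]
      simp [add_comm]
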